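/- Assuming 𝔟 = 𝔰 = 𝔠, every first countable regular Hausdorff space of cardinality less than 𝔠 embeds as a dense subspace into a first countable countably compact regular Hausdorff space. -/

import Mathlib

noncomputable def boundingNumber : Cardinal :=
  sInf {c | ∃ B : Set (ℕ → ℕ), Cardinal.mk B = c ∧
    ∀ d : ℕ → ℕ, ∃ g ∈ B, {n | d n < g n}.Infinite}

noncomputable def splittingNumber : Cardinal :=
  sInf {c | ∃ S : Set (Set ℕ), Cardinal.mk S = c ∧ (∀ s ∈ S, s.Infinite) ∧
    ∀ B : Set ℕ, B.Infinite → ∃ s ∈ S, (B ∩ s).Infinite ∧ (B \ s).Infinite}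

def CountablyCompactOn {Z : Type*} [TopologicalSpace Z] (Y : Set Z) : Prop :=
  ∀ U : ℕ → Set Z, (∀ n, IsOpen (U n)) → Y ⊆ ⋃ n, U n →
    ∃ F : Finset ℕ, Y ⊆ ⋃ n ∈ F, U n

open Set Filter Topology Cardinal

/-- Fewer than `𝔟` functions have a common eventual upper bound. -/
theorem exists_eventually_ge_of_lt_boundingNumber {ι : Type} (g : ι → ℕ → ℕ)
    (h : #ι < boundingNumber) : ∃ f : ℕ → ℕ, ∀ i, ∀ᶠ n in atTop, g i n ≤ f n := by
  by_contra! hf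
  have hle : boundingNumber ≤ #(range g) := by
    refine csInf_le' ⟨range g, rfl, fun d => ?_⟩
    obtain ⟨i, hi⟩ := hf d
    exact ⟨g i, mem_range_self i, Nat.frequently_atTop_iff_infinite.1 hi⟩
  exact absurd h (not_lt.2 (hle.trans mk_range_le))

/-- Fewer than `𝔰` sets do not split every infinite set. -/
theorem exists_unsplit_of_lt_splittingNumber {ι : Type} (s : ι → Set ℕ)
    (h : #ι < splittingNumber) : ∃ φ : ℕ → ℕ, StrictMono φ ∧
      ∀ i, (∀ᶠ n in atTop, φ n ∈ s i) ∨ ∀ᶠ n in atTop, φ n ∉ s i := by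
  have key : ∃ B : Set ℕ, B.Infinite ∧ ∀ i, (B ∩ s i).Finite ∨ (B \ s i).Finite := by
    by_contra! hB
    have hle : splittingNumber ≤ #{t ∈ range s | t.Infinite} := by
      refine csInf_le' ⟨_, rfl, fun t ht => ht.2, fun B hBi => ?_⟩
      obtain ⟨i, hi, hi'⟩ := hB B hBi
      exact ⟨s i, ⟨mem_range_self i, Set.Infinite.mono inter_subset_right hi⟩, hi, hi'⟩
    exact absurd h (not_lt.2
      (hle.trans ((mk_le_mk_of_subset (sep_subset _ _)).trans mk_range_le)))
  obtain ⟨B, hB, hs⟩ := key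
  have hφ : StrictMono (Nat.nth (· ∈ B)) := Nat.nth_strictMono hB
  have hφB : ∀ n, Nat.nth (· ∈ B) n ∈ B := Nat.nth_mem_of_infinite hB
  refine ⟨_, hφ, fun i => (hs i).symm.imp (fun h => ?_) fun h => ?_⟩
  · filter_upwards [hφ.tendsto_atTop.eventually (Nat.cofinite_eq_atTop ▸ h.compl_mem_cofinite)]
      with n hn
    by_contra hc
    exact hn ⟨hφB n, hc⟩
  · filter_upwards [hφ.tendsto_atTop.eventually (Nat.cofinite_eq_atTop ▸ h.compl_mem_cofinite)]
      with n hn hc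
    exact hn ⟨hφB n, hc⟩

/-- `M k y z` means that `z` lies in the `k`-th basic neighbourhood of `y`; the conditions say
that these neighbourhoods are open and decreasing, that the closure of each is contained in the
previous one, and that they separate points. -/
structure IsRegularBase {A : Type*} (M : ℕ → A → A → Prop) : Prop where
  refl : ∀ k y, M k y y
  mono : ∀ k y w, M (k + 1) y w → M k y w
  isOpen : ∀ k y z, M k y z → ∃ j, ∀ w, M j z w → M k y w
  regular : ∀ k y z, ¬ M k y z → ∃ j, ∀ w, M j z w → ¬ M (k + 1) y w
  sep : ∀ y z, y ≠ z → ∃ k, ¬ M k y z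

theorem IsRegularBase.anti {A : Type*} {M : ℕ → A → A → Prop} (hM : IsRegularBase M) {i j : ℕ}
    (hij : i ≤ j) {y w : A} (h : M j y w) : M i y w := by
  induction hij with
  | refl => exact h
  | step _ ih => exact ih (hM.mono _ _ _ h)

/-- One new point is added to `A`: its `k`-th neighbourhood has trace `E k` on `A`, and it is put
into the `k`-th neighbourhood of `y` when `G k y` holds. The conditions say that the result is a
regular base whenever `M` is, and that inclusion and disjointness of basic neighbourhoods are
preserved. -/
structure IsOnePointExtension {A : Type*} (M : ℕ → A → A → Prop) (E G : ℕ → A → Prop) :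
    Prop where
  incl : ∀ j k z y, (∀ w, M j z w → M k y w) → G j z → G k y
  disj : ∀ j k z y, (∀ w, M j z w → ¬ M k y w) → G j z → ¬ G k y
  mono : ∀ k w, E (k + 1) w → E k w
  isOpen_new : ∀ k z, E k z → ∃ j, ∀ w, M j z w → E k w
  isOpen_old : ∀ k y, G k y → ∃ j, ∀ w, E j w → M k y w
  regular_old : ∀ k y, ¬ G k y → ∃ j, ∀ w, E j w → ¬ M (k + 1) y w
  regular_new : ∀ k z, ¬ E k z → ∃ j, ¬ G j z ∧ ∀ w, M j z w → ¬ E (k + 1) w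
  sep_old : ∀ y, ∃ k, ¬ G k y
  sep_new : ∀ z, ∃ k, ¬ E k z

theorem isOnePointExtension_isolated {A : Type*} (M : ℕ → A → A → Prop) :
    IsOnePointExtension M (fun _ _ => False) (fun _ _ => False) := by
  constructor <;> simp

/-- In the one-point extension, `a` has a convergent subsequence. -/
def HasLimitAfter {A : Type*} (M : ℕ → A → A → Prop) (G' : ℕ → A → Prop) (a : ℕ → A) : Prop :=
  ∃ φ : ℕ → ℕ, StrictMono φ ∧
    ((∃ z, ∀ k, ∀ᶠ n in atTop, M k z (a (φ n))) ∨ ∀ k, ∀ᶠ n in atTop, G' k (a (φ n)))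

theorem exists_isOnePointExtension_hasLimitAfter
    (hb : boundingNumber = 𝔠) (hs : splittingNumber = 𝔠)
    {A : Type} (hA : #A < 𝔠) {M : ℕ → A → A → Prop} (hM : IsRegularBase M) (a : ℕ → A) :
    ∃ E G, IsOnePointExtension M E G ∧ HasLimitAfter M E a := by
  have hNA : #(ℕ × A) < 𝔠 := by
    rw [mk_prod, lift_id, lift_id]
    exact mul_lt_of_lt aleph0_le_continuum (by simpa using aleph0_lt_continuum) hA
  obtain ⟨φ, hφ, hsplit⟩ := exists_unsplit_of_lt_splittingNumber
    (fun i : ℕ × A => {n | M i.1 i.2 (a n)}) (hs ▸ hNA)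
  by_cases hconv : ∃ z, ∀ k, ∀ᶠ n in atTop, M k z (a (φ n))
  · exact ⟨_, _, isOnePointExtension_isolated M, φ, hφ, Or.inl hconv⟩
  set b : ℕ → A := fun n => a (φ n) with hbdef
  replace hsplit : ∀ k y, (∀ᶠ n in atTop, M k y (b n)) ∨ ∀ᶠ n in atTop, ¬ M k y (b n) :=
    fun k y => hsplit (k, y)
  have hfar : ∀ z, ∃ i, ∀ᶠ n in atTop, ¬ M i z (b n) := by
    push Not at hconv
    intro z
    obtain ⟨k, hk⟩ := hconv z
    exact ⟨k, (hsplit k z).resolve_left (not_eventually.2 hk)⟩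
  have hF : ∀ (i : ℕ × A) (n : ℕ), ∃ j, (M i.1 i.2 (b n) → ∀ w, M j (b n) w → M i.1 i.2 w) ∧
      (¬ M i.1 i.2 (b n) → ∀ w, M j (b n) w → ¬ M (i.1 + 1) i.2 w) := by
    intro i n
    by_cases h : M i.1 i.2 (b n)
    · obtain ⟨j, hj⟩ := hM.isOpen _ _ _ h
      exact ⟨j, fun _ => hj, fun h' => absurd h h'⟩
    · obtain ⟨j, hj⟩ := hM.regular _ _ _ h
      exact ⟨j, fun h' => absurd h' h, fun _ => hj⟩
  choose F hF₁ hF₂ using hF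
  obtain ⟨f, hf⟩ := exists_eventually_ge_of_lt_boundingNumber F (hb ▸ hNA)
  -- the neighbourhoods of the new point are eventually inside, or disjoint from, the old ones
  have hin : ∀ k y, (∀ᶠ n in atTop, M k y (b n)) →
      ∀ᶠ n in atTop, ∀ l w, M (f n + l) (b n) w → M k y w := by
    intro k y h
    filter_upwards [h, hf (k, y)] with n hn hfn l w hw
    exact hF₁ (k, y) n hn w (hM.anti (by lia) hw)
  have hout : ∀ k y, (∀ᶠ n in atTop, ¬ M k y (b n)) →
      ∀ᶠ n in atTop, ∀ l w, M (f n + l) (b n) w → ¬ M (k + 1) y w := by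
    intro k y h
    filter_upwards [h, hf (k, y)] with n hn hfn l w hw
    exact hF₂ (k, y) n hn w (hM.anti (by lia) hw)
  refine ⟨fun k w => ∃ n, k ≤ n ∧ M (f n + k) (b n) w, fun k y => ∀ᶠ n in atTop, M k y (b n),
    ⟨?_, ?_, ?_, ?_, ?_, ?_, ?_, ?_, ?_⟩, φ, hφ, Or.inr fun k => ?_⟩
  · exact fun j k z y h hz => hz.mono fun n hn => h _ hn
  · intro j k z y h hz hy
    obtain ⟨n, hn, hn'⟩ := (hz.and hy).exists
    exact h _ hn hn'
  · rintro k w ⟨n, hn, hw⟩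
    exact ⟨n, by lia, hM.anti (by lia) hw⟩
  · rintro k z ⟨n, hn, hz⟩
    obtain ⟨j, hj⟩ := hM.isOpen _ _ _ hz
    exact ⟨j, fun w hw => ⟨n, hn, hj w hw⟩⟩
  · intro k y h
    obtain ⟨j, hj⟩ := eventually_atTop.1 (hin k y h)
    exact ⟨j, fun w ⟨n, hn, hw⟩ => hj n hn _ w hw⟩
  · intro k y h
    obtain ⟨j, hj⟩ := eventually_atTop.1 (hout k y ((hsplit k y).resolve_left h))
    exact ⟨j, fun w ⟨n, hn, hw⟩ => hj n hn _ w hw⟩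
  · intro k z hz
    obtain ⟨i, hi⟩ := hfar z
    obtain ⟨m, hm⟩ := eventually_atTop.1 (hout i z hi)
    push Not at hz
    have hsmall : ∀ n, ∃ j, k ≤ n → ∀ w, M j z w → ¬ M (f n + k + 1) (b n) w := by
      intro n
      by_cases hn : k ≤ n
      · obtain ⟨j, hj⟩ := hM.regular _ _ _ (hz n hn)
        exact ⟨j, fun _ => hj⟩
      · exact ⟨0, fun h => absurd h hn⟩
    choose J hJ using hsmall
    have hle : ∀ n < m, J n ≤ (Finset.range m).sup J :=
      fun n hn => Finset.le_sup (Finset.mem_range.2 hn)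
    refine ⟨max (i + 1) ((Finset.range m).sup J), fun h => ?_, ?_⟩
    · obtain ⟨n, hn, hn'⟩ := (h.and hi).exists
      exact hn' (hM.anti (by lia) hn)
    · rintro w hw ⟨n, hn, hw'⟩
      rcases lt_or_ge n m with hnm | hnm
      · exact hJ n (by lia) w (hM.anti ((hle n hnm).trans (le_max_right _ _)) hw) hw'
      · exact hm n hnm _ w hw' (hM.anti (le_max_left _ _) hw)
  · intro y
    obtain ⟨i, hi⟩ := hfar y
    refine ⟨i, fun h => ?_⟩
    obtain ⟨n, hn, hn'⟩ := (h.and hi).exists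
    exact hn' hn
  · intro z
    obtain ⟨i, hi⟩ := hfar z
    obtain ⟨m, hm⟩ := eventually_atTop.1 (hout i z hi)
    exact ⟨m, fun ⟨n, hn, hw⟩ => hm n hn _ z hw (hM.refl _ _)⟩
  · filter_upwards [eventually_ge_atTop k] with n hn
    exact ⟨n, hn, hM.refl _ _⟩

theorem exists_forall_of_forall_update {I D : Type*} [LinearOrder I] [WellFoundedLT I]
    [Inhabited D] (P : I → (I → D) → Prop)
    (local_of : ∀ α d d', (∀ β ≤ α, d β = d' β) → P α d → P α d')
    (step : ∀ α d, (∀ β < α, P β d) → ∃ e, P α (Function.update d α e)) :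
    ∃ d, ∀ α, P α d := by
  classical
  let ext (α : I) (prev : ∀ β, β < α → D) : I → D :=
    fun β => if h : β < α then prev β h else default
  let F (α : I) (prev : ∀ β, β < α → D) : D :=
    if h : ∃ e, P α (Function.update (ext α prev) α e) then h.choose else default
  let d : I → D := (wellFounded_lt (α := I)).fix F
  have hd : ∀ α, d α = F α (fun β _ => d β) := fun α => WellFounded.fix_eq _ F α
  refine ⟨d, fun α => ?_⟩
  induction α using WellFoundedLT.induction with
  | ind α ih =>
    have hext : ∀ β < α, ext α (fun β _ => d β) β = d β := fun β hβ => dif_pos hβ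
    have h : ∃ e, P α (Function.update (ext α (fun β _ => d β)) α e) :=
      step _ _ fun β hβ => local_of β d _ (fun γ hγ => (hext γ (hγ.trans_lt hβ)).symm) (ih β hβ)
    refine local_of α _ _ (fun β hβ => ?_) h.choose_spec
    rcases hβ.lt_or_eq with hβ | rfl
    · rw [Function.update_of_ne hβ.ne, hext β hβ]
    · rw [Function.update_self, hd]
      exact (dif_pos h).symm

section Glue

variable {X I : Type*}

/-- The points of `X` together with the new points indexed by `T`. -/
def stage (X : Type*) {I : Type*} (T : Set I) : Set (X ⊕ I) :=
  {z | ∀ β, z = Sum.inr β → β ∈ T}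

theorem inl_mem_stage (T : Set I) (x : X) : Sum.inl x ∈ stage X T := by
  simp [stage]

@[simp]
theorem inr_mem_stage {T : Set I} {β : I} : Sum.inr β ∈ stage X T ↔ β ∈ T := by
  simp [stage]

theorem stage_mono {S T : Set I} (h : S ⊆ T) : stage X S ⊆ stage X T :=
  fun _ hz β hβ => h (hz β hβ)

theorem forall_mem_stage_empty {p : X ⊕ I → Prop} (h : ∀ x, p (Sum.inl x)) :
    ∀ w ∈ stage X (∅ : Set I), p w := by
  rintro (x | β) hw
  · exact h x
  · exact absurd (inr_mem_stage.1 hw) (notMem_empty β)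

variable [LinearOrder I]

/-- The neighbourhoods on `X ⊕ I` obtained from neighbourhoods `B` on `X` and, for each `β : I`,
the one-point extension data `d β` of the new point `β` over all points before it. -/
noncomputable def glue (B : ℕ → X → X → Prop)
    (d : I → (ℕ → X ⊕ I → Prop) × (ℕ → X ⊕ I → Prop)) (k : ℕ) : X ⊕ I → X ⊕ I → Prop
  | Sum.inl x, Sum.inl y => B k x y
  | Sum.inl x, Sum.inr γ => (d γ).2 k (Sum.inl x)
  | Sum.inr γ, Sum.inl x => (d γ).1 k (Sum.inl x)
  | Sum.inr β, Sum.inr γ =>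
    if γ < β then (d β).1 k (Sum.inr γ) else if β < γ then (d γ).2 k (Sum.inr β) else True

/-- The neighbourhoods `glue B d` restricted to a stage. -/
def glueOn (B : ℕ → X → X → Prop) (d : I → (ℕ → X ⊕ I → Prop) × (ℕ → X ⊕ I → Prop))
    (T : Set I) (k : ℕ) (y z : stage X T) : Prop :=
  glue B d k y z

variable {B : ℕ → X → X → Prop} {d d' : I → (ℕ → X ⊕ I → Prop) × (ℕ → X ⊕ I → Prop)}

theorem glue_inr_left {α : I} {w : X ⊕ I} (hw : w ∈ stage X (Iio α)) (k : ℕ) :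
    glue B d k (Sum.inr α) w ↔ (d α).1 k w := by
  rcases w with x | β
  · rfl
  · have : β < α := mem_Iio.1 (inr_mem_stage.1 hw)
    simp [glue, this]

theorem glue_inr_right {α : I} {w : X ⊕ I} (hw : w ∈ stage X (Iio α)) (k : ℕ) :
    glue B d k w (Sum.inr α) ↔ (d α).2 k w := by
  rcases w with x | β
  · rfl
  · have : β < α := mem_Iio.1 (inr_mem_stage.1 hw)
    simp [glue, this, this.not_gt]

theorem glue_inr_self (α : I) (k : ℕ) : glue B d k (Sum.inr α) (Sum.inr α) := by
  simp [glue]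

theorem glue_refl (hB : IsRegularBase B) (k : ℕ) (y : X ⊕ I) : glue B d k y y := by
  rcases y with y | β
  · exact hB.refl k y
  · exact glue_inr_self β k

theorem glueOn_congr {T : Set I} (h : ∀ β ∈ T, d β = d' β) : glueOn B d T = glueOn B d' T := by
  funext k ⟨y, hy⟩ ⟨z, hz⟩
  rcases y with y | β <;> rcases z with z | γ
  · rfl
  · simp [glueOn, glue, h γ (inr_mem_stage.1 hz)]
  · simp [glueOn, glue, h β (inr_mem_stage.1 hy)]
  · simp [glueOn, glue, h β (inr_mem_stage.1 hy), h γ (inr_mem_stage.1 hz)]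

/-- The point `α` is a one-point extension of all points before it. -/
def ExtendsAt (B : ℕ → X → X → Prop) (d : I → (ℕ → X ⊕ I → Prop) × (ℕ → X ⊕ I → Prop))
    (α : I) : Prop :=
  IsOnePointExtension (glueOn B d (Iio α)) (fun k w => (d α).1 k w) (fun k w => (d α).2 k w)

theorem glue_cases (y z : X ⊕ I) :
    (y ∈ stage X (∅ : Set I) ∧ z ∈ stage X (∅ : Set I)) ∨ ∃ γ,
      (y = Sum.inr γ ∧ z = Sum.inr γ) ∨ (y = Sum.inr γ ∧ z ∈ stage X (Iio γ)) ∨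
      (z = Sum.inr γ ∧ y ∈ stage X (Iio γ)) := by
  rcases y with y | β <;> rcases z with z | γ
  · exact Or.inl ⟨inl_mem_stage _ _, inl_mem_stage _ _⟩
  · exact Or.inr ⟨γ, Or.inr (Or.inr ⟨rfl, inl_mem_stage _ _⟩)⟩
  · exact Or.inr ⟨β, Or.inr (Or.inl ⟨rfl, inl_mem_stage _ _⟩)⟩
  · rcases lt_trichotomy β γ with h | rfl | h
    · exact Or.inr ⟨γ, Or.inr (Or.inr ⟨rfl, inr_mem_stage.2 h⟩)⟩
    · exact Or.inr ⟨β, Or.inl ⟨rfl, rfl⟩⟩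
    · exact Or.inr ⟨β, Or.inr (Or.inl ⟨rfl, inr_mem_stage.2 h⟩)⟩

theorem forall_mem_stage_Iic {γ : I} {p : X ⊕ I → Prop} (hγ : p (Sum.inr γ))
    (h : ∀ w ∈ stage X (Iio γ), p w) : ∀ w ∈ stage X (Iic γ), p w := by
  rintro (x | β) hw
  · exact h _ (inl_mem_stage _ _)
  · rcases (mem_Iic.1 (inr_mem_stage.1 hw)).lt_or_eq with hβ | rfl
    · exact h _ (inr_mem_stage.2 hβ)
    · exact hγ

variable [WellFoundedLT I]

/-- Relations between basic neighbourhoods preserved by every one-point extension persist to all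
later stages. -/
theorem glue_persist {S T : Set I} (hS : IsLowerSet S) (hT : IsLowerSet T)
    {y z : X ⊕ I} (hy : y ∈ stage X S) (hz : z ∈ stage X S) {p : X ⊕ I → Prop}
    (hp : ∀ γ ∈ T, y ∈ stage X (Iio γ) → z ∈ stage X (Iio γ) →
      (∀ w ∈ stage X (Iio γ), p w) → p (Sum.inr γ))
    (h : ∀ w ∈ stage X S, p w) : ∀ w ∈ stage X T, p w := by
  have key : ∀ γ ∈ T, p (Sum.inr γ) := by
    intro γ
    induction γ using WellFoundedLT.induction with
    | ind γ ih =>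
      intro hγ
      by_cases hγS : γ ∈ S
      · exact h _ (inr_mem_stage.2 hγS)
      · have hSγ : S ⊆ Iio γ := fun β hβ => not_le.1 fun hle => hγS (hS hle hβ)
        refine hp γ hγ (stage_mono hSγ hy) (stage_mono hSγ hz) ?_
        rintro (x | β) hw
        · exact h _ (inl_mem_stage _ _)
        · have hβ : β < γ := mem_Iio.1 (inr_mem_stage.1 hw)
          exact ih β hβ (hT hβ.le hγ)
  rintro (x | β) hw
  · exact h _ (inl_mem_stage _ _)
  · exact key β (inr_mem_stage.1 hw)

theorem glue_incl_persist {S T : Set I} (hS : IsLowerSet S) (hT : IsLowerSet T)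
    (hd : ∀ γ ∈ T, ExtendsAt B d γ) {y z : X ⊕ I} (hy : y ∈ stage X S) (hz : z ∈ stage X S)
    {j k : ℕ} (h : ∀ w ∈ stage X S, glue B d j z w → glue B d k y w) :
    ∀ w ∈ stage X T, glue B d j z w → glue B d k y w := by
  refine glue_persist hS hT hy hz (fun γ hγ hy hz hlt => ?_) h
  rw [glue_inr_right hz, glue_inr_right hy]
  exact (hd γ hγ).incl j k ⟨z, hz⟩ ⟨y, hy⟩ fun w => hlt w w.2

theorem glue_disj_persist {S T : Set I} (hS : IsLowerSet S) (hT : IsLowerSet T)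
    (hd : ∀ γ ∈ T, ExtendsAt B d γ) {y z : X ⊕ I} (hy : y ∈ stage X S) (hz : z ∈ stage X S)
    {j k : ℕ} (h : ∀ w ∈ stage X S, glue B d j z w → ¬ glue B d k y w) :
    ∀ w ∈ stage X T, glue B d j z w → ¬ glue B d k y w := by
  refine glue_persist hS hT hy hz (fun γ hγ hy hz hlt => ?_) h
  rw [glue_inr_right hz, glue_inr_right hy]
  exact (hd γ hγ).disj j k ⟨z, hz⟩ ⟨y, hy⟩ fun w => hlt w w.2

theorem isRegularBase_glueOn (hB : IsRegularBase B) {T : Set I} (hT : IsLowerSet T)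
    (hd : ∀ γ ∈ T, ExtendsAt B d γ) : IsRegularBase (glueOn B d T) := by
  have lower_empty : IsLowerSet (∅ : Set I) := isLowerSet_empty
  have mono : ∀ k, ∀ y ∈ stage X T, ∀ w ∈ stage X T, glue B d (k + 1) y w → glue B d k y w := by
    rintro k (x | γ) hy
    · exact glue_incl_persist lower_empty hT hd (inl_mem_stage _ x) (inl_mem_stage _ x)
        (forall_mem_stage_empty fun w => hB.mono k x w)
    · have hγ : Sum.inr γ ∈ stage X (Iic γ) := inr_mem_stage.2 (mem_Iic.2 le_rfl)
      refine glue_incl_persist (isLowerSet_Iic γ) hT hd hγ hγ (forall_mem_stage_Iic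
        (fun _ => glue_inr_self γ k) fun w hw => ?_)
      rw [glue_inr_left hw, glue_inr_left hw]
      exact (hd γ (inr_mem_stage.1 hy)).mono k ⟨w, hw⟩
  have mem_Iic_of_lt : ∀ {γ : I} {z : X ⊕ I}, z ∈ stage X (Iio γ) → z ∈ stage X (Iic γ) :=
    fun hz => stage_mono Iio_subset_Iic_self hz
  refine ⟨fun k y => glue_refl hB k y.1, fun k y w => mono k y y.2 w w.2, ?_, ?_, ?_⟩
  · rintro k ⟨y, hy⟩ ⟨z, hz⟩ (h : glue B d k y z)
    suffices ∃ j, ∀ w ∈ stage X T, glue B d j z w → glue B d k y w by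
      obtain ⟨j, hj⟩ := this
      exact ⟨j, fun w => hj w w.2⟩
    rcases glue_cases y z with ⟨hy0, hz0⟩ | ⟨γ, ⟨rfl, rfl⟩ | ⟨rfl, hlt⟩ | ⟨rfl, hlt⟩⟩
    · rcases y with y | β
      · rcases z with z | β
        · obtain ⟨j, hj⟩ := hB.isOpen k y z h
          exact ⟨j, glue_incl_persist lower_empty hT hd hy0 hz0 (forall_mem_stage_empty hj)⟩
        · simp at hz0
      · simp at hy0
    · exact ⟨k, fun w _ hw => hw⟩
    · rw [glue_inr_left hlt] at h
      obtain ⟨j, hj⟩ := (hd γ (inr_mem_stage.1 hy)).isOpen_new k ⟨z, hlt⟩ h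
      refine ⟨j, glue_incl_persist (isLowerSet_Iic γ) hT hd (by simp) (mem_Iic_of_lt hlt)
        (forall_mem_stage_Iic (fun _ => glue_inr_self γ k) fun w hw hw' => ?_)⟩
      rw [glue_inr_left hw]
      exact hj ⟨w, hw⟩ hw'
    · have h' := h
      rw [glue_inr_right hlt] at h
      obtain ⟨j, hj⟩ := (hd γ (inr_mem_stage.1 hz)).isOpen_old k ⟨y, hlt⟩ h
      refine ⟨j, glue_incl_persist (isLowerSet_Iic γ) hT hd (mem_Iic_of_lt hlt) (by simp)
        (forall_mem_stage_Iic (fun _ => h') fun w hw hw' => ?_)⟩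
      rw [glue_inr_left hw] at hw'
      exact hj ⟨w, hw⟩ hw'
  · rintro k ⟨y, hy⟩ ⟨z, hz⟩ (h : ¬ glue B d k y z)
    suffices ∃ j, ∀ w ∈ stage X T, glue B d j z w → ¬ glue B d (k + 1) y w by
      obtain ⟨j, hj⟩ := this
      exact ⟨j, fun w => hj w w.2⟩
    rcases glue_cases y z with ⟨hy0, hz0⟩ | ⟨γ, ⟨rfl, rfl⟩ | ⟨rfl, hlt⟩ | ⟨rfl, hlt⟩⟩
    · rcases y with y | β
      · rcases z with z | β
        · obtain ⟨j, hj⟩ := hB.regular k y z h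
          exact ⟨j, glue_disj_persist lower_empty hT hd hy0 hz0 (forall_mem_stage_empty hj)⟩
        · simp at hz0
      · simp at hy0
    · exact absurd (glue_inr_self γ k) h
    · rw [glue_inr_left hlt] at h
      obtain ⟨j, hjγ, hj⟩ := (hd γ (inr_mem_stage.1 hy)).regular_new k ⟨z, hlt⟩ h
      refine ⟨j, glue_disj_persist (isLowerSet_Iic γ) hT hd (by simp) (mem_Iic_of_lt hlt)
        (forall_mem_stage_Iic (fun hγ => ?_) fun w hw hw' => ?_)⟩
      · rw [glue_inr_right hlt] at hγ
        exact absurd hγ hjγ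
      · rw [glue_inr_left hw]
        exact hj ⟨w, hw⟩ hw'
    · have h' : ¬ glue B d (k + 1) y (Sum.inr γ) := fun h' => h (mono k y hy _ hz h')
      rw [glue_inr_right hlt] at h
      obtain ⟨j, hj⟩ := (hd γ (inr_mem_stage.1 hz)).regular_old k ⟨y, hlt⟩ h
      refine ⟨j, glue_disj_persist (isLowerSet_Iic γ) hT hd (mem_Iic_of_lt hlt) (by simp)
        (forall_mem_stage_Iic (fun _ => h') fun w hw hw' => ?_)⟩
      rw [glue_inr_left hw] at hw'
      exact hj ⟨w, hw⟩ hw'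
  · rintro ⟨y, hy⟩ ⟨z, hz⟩ hne
    replace hne : y ≠ z := fun h => hne (Subtype.ext h)
    change ∃ k, ¬ glue B d k y z
    rcases glue_cases y z with ⟨hy0, hz0⟩ | ⟨γ, ⟨rfl, rfl⟩ | ⟨rfl, hlt⟩ | ⟨rfl, hlt⟩⟩
    · rcases y with y | β
      · rcases z with z | β
        · exact hB.sep y z fun h => hne (congrArg _ h)
        · simp at hz0
      · simp at hy0
    · exact absurd rfl hne
    · simp only [glue_inr_left hlt]
      exact (hd γ (inr_mem_stage.1 hy)).sep_new ⟨z, hlt⟩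
    · simp only [glue_inr_right hlt]
      exact (hd γ (inr_mem_stage.1 hz)).sep_old ⟨y, hlt⟩

end Glue

/-- The topology in which the sets `{w | M k y w}` are the basic neighbourhoods of `y`. -/
@[reducible]
def baseTopology {Z : Type*} (M : ℕ → Z → Z → Prop) : TopologicalSpace Z :=
  TopologicalSpace.mkOfNhds fun y => ⨅ k, 𝓟 {w | M k y w}

theorem IsRegularBase.hasBasis_nhds {Z : Type*} {M : ℕ → Z → Z → Prop} (hM : IsRegularBase M)
    (y : Z) : (@nhds Z (baseTopology M) y).HasBasis (fun _ => True) fun k => {w | M k y w} := by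
  have hbasis : ∀ y, (⨅ k, 𝓟 {w | M k y w}).HasBasis (fun _ => True) fun k => {w | M k y w} :=
    fun y => hasBasis_iInf_principal
      (directed_of_isDirected_le fun i j hij w hw => hM.anti hij hw)
  rw [TopologicalSpace.nhds_mkOfNhds_of_hasBasis hbasis (fun y k _ => hM.refl k y)
    (fun y k _ => ?_) y]
  · exact hbasis y
  · refine (hbasis y).eventually_iff.2 ⟨k, trivial, fun z hz => ?_⟩
    obtain ⟨j, hj⟩ := hM.isOpen k y z hz
    exact (hbasis z).mem_iff.2 ⟨j, trivial, hj⟩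

theorem IsRegularBase.firstCountable_regular_t2 {Z : Type*} {M : ℕ → Z → Z → Prop}
    (hM : IsRegularBase M) :
    @FirstCountableTopology Z (baseTopology M) ∧ @RegularSpace Z (baseTopology M) ∧
      @T2Space Z (baseTopology M) := by
  let _ := baseTopology M
  have hfc : FirstCountableTopology Z := ⟨fun y => (hM.hasBasis_nhds y).isCountablyGenerated⟩
  have hreg : RegularSpace Z := by
    refine .of_exists_mem_nhds_isClosed_subset fun y s hs => ?_
    obtain ⟨k, -, hk⟩ := (hM.hasBasis_nhds y).mem_iff.1 hs
    refine ⟨closure {w | M (k + 1) y w}, mem_of_superset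
      ((hM.hasBasis_nhds y).mem_of_mem trivial) subset_closure, isClosed_closure,
      fun z hz => hk ?_⟩
    by_contra hkz
    obtain ⟨j, hj⟩ := hM.regular k y z hkz
    obtain ⟨w, hw, hw'⟩ := mem_closure_iff_nhds.1 hz _
      ((hM.hasBasis_nhds z).mem_of_mem (i := j) trivial)
    exact hj w hw hw'
  have ht1 : T1Space Z := by
    refine t1Space_iff_exists_open.2 fun y z hyz => ?_
    obtain ⟨k, hk⟩ := hM.sep y z hyz
    obtain ⟨U, hU, hUo, hyU⟩ := mem_nhds_iff.1
      ((hM.hasBasis_nhds y).mem_of_mem (i := k) trivial)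
    exact ⟨U, hUo, hyU, fun hz => hk (hU hz)⟩
  exact ⟨hfc, hreg, inferInstance⟩

theorem exists_isRegularBase_hasBasis_nhds (X : Type*) [TopologicalSpace X]
    [FirstCountableTopology X] [RegularSpace X] [T2Space X] :
    ∃ B : ℕ → X → X → Prop, IsRegularBase B ∧
      ∀ x, (𝓝 x).HasBasis (fun _ => True) fun k => {w | B k x w} := by
  have key : ∀ x : X, ∃ U : ℕ → Set X, (∀ n, IsOpen (U n)) ∧ (∀ n, x ∈ U n) ∧
      (∀ n, closure (U (n + 1)) ⊆ U n) ∧ (𝓝 x).HasBasis (fun _ => True) U := by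
    intro x
    obtain ⟨V, hV⟩ := (𝓝 x).exists_antitone_basis
    have hstep : ∀ W : {W : Set X // IsOpen W ∧ x ∈ W}, ∀ n,
        ∃ O : {W : Set X // IsOpen W ∧ x ∈ W}, closure (O : Set X) ⊆ W ∩ V n := by
      rintro ⟨W, hWo, hxW⟩ n
      obtain ⟨t, ht, htc, htW⟩ := exists_mem_nhds_isClosed_subset
        (inter_mem (hWo.mem_nhds hxW) (hV.1.mem_of_mem (i := n) trivial))
      exact ⟨⟨interior t, isOpen_interior, mem_interior_iff_mem_nhds.2 ht⟩,
        (closure_minimal interior_subset htc).trans htW⟩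
    choose O hO using hstep
    let U : ℕ → {W : Set X // IsOpen W ∧ x ∈ W} :=
      fun n => Nat.rec ⟨Set.univ, isOpen_univ, mem_univ x⟩ (fun n W => O W n) n
    have hU : ∀ n, closure (U (n + 1)).1 ⊆ (U n).1 ∩ V n := by
      intro n
      exact hO (U n) n
    refine ⟨fun n => (U n).1, fun n => (U n).2.1, fun n => (U n).2.2,
      fun n => (hU n).trans inter_subset_left, hV.1.to_hasBasis (fun n _ => ?_) fun n _ => ?_⟩
    · exact ⟨n + 1, trivial, subset_closure.trans ((hU n).trans inter_subset_right)⟩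
    · exact hV.1.mem_iff.1 ((U n).2.1.mem_nhds (U n).2.2)
  choose U hUo hxU hcl hbasis using key
  refine ⟨fun k x w => w ∈ U x k, ⟨fun k y => hxU y k, ?_, ?_, ?_, ?_⟩, hbasis⟩
  · exact fun k y w hw => hcl y k (subset_closure hw)
  · intro k y z hz
    obtain ⟨j, -, hj⟩ := (hbasis z).mem_iff.1 ((hUo y k).mem_nhds hz)
    exact ⟨j, fun w hw => hj hw⟩
  · intro k y z hz
    have hz' : (closure (U y (k + 1)))ᶜ ∈ 𝓝 z :=
      isClosed_closure.isOpen_compl.mem_nhds fun h => hz (hcl y k h)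
    obtain ⟨j, -, hj⟩ := (hbasis z).mem_iff.1 hz'
    exact ⟨j, fun w hw hw' => hj hw (subset_closure hw')⟩
  · intro y z hyz
    obtain ⟨k, -, hk⟩ := (hbasis y).mem_iff.1 (isOpen_ne.mem_nhds hyz)
    exact ⟨k, fun h => hk h rfl⟩

theorem countablyCompactOn_univ_of_subseq {Y : Type*} [TopologicalSpace Y]
    (h : ∀ a : ℕ → Y, ∃ φ : ℕ → ℕ, StrictMono φ ∧ ∃ y, Tendsto (a ∘ φ) atTop (𝓝 y)) :
    CountablyCompactOn (Set.univ : Set Y) := by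
  intro U hU hcov
  by_contra! hF
  have hF' : ∀ n : ℕ, ∃ y, ∀ i < n, y ∉ U i := by
    intro n
    obtain ⟨y, -, hy⟩ := not_subset.1 (hF (Finset.range n))
    exact ⟨y, fun i hi hyi => hy (mem_biUnion (Finset.mem_coe.2 (Finset.mem_range.2 hi)) hyi)⟩
  choose a ha using hF'
  obtain ⟨φ, hφ, y, hy⟩ := h a
  obtain ⟨m, hm⟩ := mem_iUnion.1 (hcov (mem_univ y))
  obtain ⟨n, hn, hnm⟩ := ((hy.eventually ((hU m).mem_nhds hm)).and
    (hφ.tendsto_atTop.eventually_gt_atTop m)).exists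
  exact ha _ m hnm hn

theorem mk_stage_lt {X I : Type} {T : Set I} (hX : #X < 𝔠) (hT : #T < 𝔠) :
    #(stage X T) < 𝔠 := by
  have hsub : stage X T ⊆ range Sum.inl ∪ Sum.inr '' T := by
    rintro (x | β) hz
    · exact Or.inl (mem_range_self x)
    · exact Or.inr (mem_image_of_mem _ (inr_mem_stage.1 hz))
  exact ((mk_le_mk_of_subset hsub).trans (mk_union_le _ _)).trans_lt
    (add_lt_of_lt aleph0_le_continuum (mk_range_le.trans_lt hX) (mk_image_le.trans_lt hT))

/-- A well-ordered type of order type the initial ordinal of `𝔠`. -/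
abbrev ContinuumIndex : Type := (Cardinal.continuum.{0}).ord.ToType

theorem mk_Iio_continuum_lt (α : ContinuumIndex) : #(Iio α) < 𝔠 := by
  simpa using mk_Iio_lt α (by simp)

theorem mk_Iic_continuum_lt (α : ContinuumIndex) : #(Iic α) < 𝔠 := by
  rw [← Iio_union_right]
  exact (mk_union_le _ _).trans_lt (add_lt_of_lt aleph0_le_continuum (mk_Iio_continuum_lt α)
    (by simpa using one_lt_aleph0.trans aleph0_lt_continuum))

/-- Every countable set of indices is bounded, since `𝔠` has uncountable cofinality. -/
theorem exists_forall_lt_continuum (b : ℕ → ContinuumIndex) : ∃ β, ∀ n, b n < β := by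
  by_contra! h
  have hcov : (⋃ n, Iic (b n)) = Set.univ := eq_univ_of_forall fun β => mem_iUnion.2 (h β)
  have hlt := sum_lt_prod (fun n => #(Iic (b n))) (fun _ => 𝔠) fun n => mk_Iic_continuum_lt (b n)
  have hle := mk_iUnion_le_sum_mk (f := fun n => Iic (b n))
  rw [hcov, mk_univ, mk_ord_toType] at hle
  simp at hlt
  exact absurd hlt (not_lt.2 hle)

/-- Every sequence in `X ⊕ I`, with `I` of order type `𝔠`, is listed at an index beyond all
its terms. -/
theorem exists_enumeration_sequences {X : Type} (hX : #X < 𝔠) :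
    ∃ task : ContinuumIndex → ℕ → X ⊕ ContinuumIndex, ∀ a, ∃ α, task α = a ∧
      ∀ n, a n ∈ stage X (Iio α) := by
  have hZ : #(X ⊕ ContinuumIndex) = 𝔠 := by
    rw [mk_sum, mk_ord_toType, lift_id, lift_id]
    exact add_eq_right aleph0_le_continuum hX.le
  have hseq : #((ℕ → X ⊕ ContinuumIndex) × ContinuumIndex) = #ContinuumIndex := by
    simp [hZ]
  obtain ⟨e⟩ := Cardinal.eq.1 hseq
  refine ⟨fun α => (e.symm α).1, fun a => ?_⟩
  have hne : Nonempty ContinuumIndex := nonempty_ord_toType continuum_ne_zero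
  obtain ⟨β, hβ⟩ := exists_forall_lt_continuum fun n => (a n).elim (fun _ => hne.some) id
  have hex : ∃ i, β < e (a, i) := by
    by_contra! hle
    refine absurd (mk_Iic_continuum_lt β) (not_lt.2 ?_)
    have := mk_le_of_injective (f := fun i => (⟨e (a, i), hle i⟩ : Iic β)) fun i j hij =>
      (Prod.mk.inj (e.injective (congrArg Subtype.val hij))).2
    rwa [mk_ord_toType] at this
  obtain ⟨i, hi⟩ := hex
  refine ⟨e (a, i), by simp, fun n γ hγ => ?_⟩
  have := hβ n
  rw [hγ] at this
  exact this.trans hi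

/-- The transfinite construction: a regular base on `X` extends to a regular base on `X ⊕ I` in
which every sequence has a convergent subsequence. -/
theorem exists_glue_isRegularBase_subseq
    (hb : boundingNumber = 𝔠) (hs : splittingNumber = 𝔠)
    {X : Type} (hX : #X < 𝔠) {B : ℕ → X → X → Prop} (hB : IsRegularBase B) :
    ∃ d : ContinuumIndex → (ℕ → X ⊕ ContinuumIndex → Prop) × (ℕ → X ⊕ ContinuumIndex → Prop),
      IsRegularBase (glue B d) ∧ ∀ a : ℕ → X ⊕ ContinuumIndex, ∃ φ : ℕ → ℕ, StrictMono φ ∧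
        ∃ z, ∀ k, ∀ᶠ n in atTop, glue B d k z (a (φ n)) := by
  obtain ⟨task, htask⟩ := exists_enumeration_sequences hX
  have hex : ∃ d : ContinuumIndex →
      (ℕ → X ⊕ ContinuumIndex → Prop) × (ℕ → X ⊕ ContinuumIndex → Prop),
      ∀ α, ExtendsAt B d α ∧ ∀ a : ℕ → stage X (Iio α), (∀ n, (a n : X ⊕ _) = task α n) →
        HasLimitAfter (glueOn B d (Iio α)) (fun k w => (d α).1 k w) a := by
    refine exists_forall_of_forall_update _ ?_ ?_
    · rintro α d d' hdd' ⟨h₁, h₂⟩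
      rw [ExtendsAt, glueOn_congr fun β hβ => hdd' β (mem_Iio.1 hβ).le, hdd' α le_rfl] at h₁
      rw [glueOn_congr fun β hβ => hdd' β (mem_Iio.1 hβ).le, hdd' α le_rfl] at h₂
      exact ⟨h₁, h₂⟩
    · intro α d hd
      have hbase := isRegularBase_glueOn hB (isLowerSet_Iio α) fun γ hγ => (hd γ hγ).1
      have hcard := mk_stage_lt hX (mk_Iio_continuum_lt α)
      have hstep : ∃ E G, IsOnePointExtension (glueOn B d (Iio α)) E G ∧
          ∀ a : ℕ → stage X (Iio α), (∀ n, (a n : X ⊕ _) = task α n) →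
            HasLimitAfter (glueOn B d (Iio α)) E a := by
        by_cases ht : ∀ n, task α n ∈ stage X (Iio α)
        · obtain ⟨E, G, h, hlim⟩ := exists_isOnePointExtension_hasLimitAfter hb hs hcard hbase
            fun n => ⟨task α n, ht n⟩
          refine ⟨E, G, h, fun a ha => ?_⟩
          rwa [show a = fun n => ⟨task α n, ht n⟩ from funext fun n => Subtype.ext (ha n)]
        · exact ⟨_, _, isOnePointExtension_isolated _,
            fun a ha => absurd (fun n => ha n ▸ (a n).2) ht⟩
      obtain ⟨E, G, h, hlim⟩ := hstep
      have hglue : ∀ e, glueOn B (Function.update d α e) (Iio α) = glueOn B d (Iio α) :=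
        fun e => glueOn_congr fun β hβ => Function.update_of_ne (ne_of_lt (mem_Iio.1 hβ)) _ _
      refine ⟨(fun k z => ∃ hz, E k ⟨z, hz⟩, fun k z => ∃ hz, G k ⟨z, hz⟩), ?_⟩
      rw [ExtendsAt, hglue]
      simpa using ⟨h, hlim⟩
  obtain ⟨d, hd⟩ := hex
  refine ⟨d, ?_, fun a => ?_⟩
  · have h := isRegularBase_glueOn hB (isLowerSet_univ (α := ContinuumIndex)) fun γ _ => (hd γ).1
    have hu : ∀ z, z ∈ stage X (Set.univ : Set ContinuumIndex) := fun z β _ => mem_univ β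
    refine ⟨fun k y => h.refl k ⟨y, hu y⟩, fun k y w => h.mono k ⟨y, hu y⟩ ⟨w, hu w⟩,
      fun k y z hz => ?_, fun k y z hz => ?_, fun y z hyz => ?_⟩
    · obtain ⟨j, hj⟩ := h.isOpen k ⟨y, hu y⟩ ⟨z, hu z⟩ hz
      exact ⟨j, fun w => hj ⟨w, hu w⟩⟩
    · obtain ⟨j, hj⟩ := h.regular k ⟨y, hu y⟩ ⟨z, hu z⟩ hz
      exact ⟨j, fun w => hj ⟨w, hu w⟩⟩
    · exact h.sep ⟨y, hu y⟩ ⟨z, hu z⟩ fun he => hyz (congrArg Subtype.val he)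
  · obtain ⟨α, rfl, hα⟩ := htask a
    obtain ⟨φ, hφ, ⟨z, hz⟩ | hz⟩ := (hd α).2 (fun n => ⟨task α n, hα n⟩) fun n => rfl
    · exact ⟨φ, hφ, z, hz⟩
    · refine ⟨φ, hφ, Sum.inr α, fun k => (hz k).mono fun n hn => ?_⟩
      exact (glue_inr_left (hα _) k).2 hn

/-- Assuming `𝔟 = 𝔰 = 𝔠`, every first countable regular Hausdorff space of
cardinality `< 𝔠` embeds as a dense subspace into a first countable countably
compact regular Hausdorff space. -/
theorem stmt12 (hb : boundingNumber = Cardinal.continuum)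
    (hs : splittingNumber = Cardinal.continuum)
    (X : Type) [TopologicalSpace X] [FirstCountableTopology X]
    [RegularSpace X] [T2Space X]
    (hcard : Cardinal.mk X < Cardinal.continuum) :
    ∃ (Y : Type) (tY : TopologicalSpace Y),
      @FirstCountableTopology Y tY ∧ @RegularSpace Y tY ∧ @T2Space Y tY ∧
      @CountablyCompactOn Y tY Set.univ ∧
      ∃ e : X → Y, @Topology.IsEmbedding _ _ _ tY e ∧ @Dense Y tY (Set.range e) := by
  obtain ⟨B, hB, hBnhds⟩ := exists_isRegularBase_hasBasis_nhds X
  obtain ⟨d, hM, hsub⟩ := exists_glue_isRegularBase_subseq hb hs hcard hB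
  let _ := baseTopology (glue B d)
  obtain ⟨hfc, hreg, ht2⟩ := hM.firstCountable_regular_t2
  have hemb : IsEmbedding (Sum.inl : X → X ⊕ ContinuumIndex) := by
    refine ⟨isInducing_iff_nhds.2 fun x => ?_, Sum.inl_injective⟩
    exact (hBnhds x).eq_of_same_basis ((hM.hasBasis_nhds (Sum.inl x)).comap Sum.inl)
  set C := closure (range (Sum.inl : X → X ⊕ ContinuumIndex)) with hC
  have hmem : ∀ x, (Sum.inl x : X ⊕ ContinuumIndex) ∈ C :=
    fun x => subset_closure (mem_range_self x)
  refine ⟨C, inferInstance, inferInstance, inferInstance, inferInstance, ?_,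
    codRestrict Sum.inl C hmem, hemb.codRestrict C hmem, fun y => ?_⟩
  · refine countablyCompactOn_univ_of_subseq fun a => ?_
    obtain ⟨φ, hφ, z, hz⟩ := hsub fun n => a n
    have hlim : Tendsto (fun n => (a (φ n) : X ⊕ ContinuumIndex)) atTop (𝓝 z) :=
      (hM.hasBasis_nhds z).tendsto_right_iff.2 fun k _ => hz k
    have hzC : z ∈ C := isClosed_closure.mem_of_tendsto hlim (.of_forall fun n => (a (φ n)).2)
    exact ⟨φ, hφ, ⟨z, hzC⟩, tendsto_subtype_rng.2 hlim⟩
  · rw [closure_subtype, ← range_comp]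
    exact y.2
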